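/- The gate R = diag(1,1,−1) is not an element of the single-qutrit Clifford+T group, i.e., R does not belong to the subgroup of U(3, ℂ) generated by the matrices H, S, and T. -/

import Mathlib

/-- `ω = e^{2πi/3}`. -/
noncomputable def ω : ℂ := Complex.exp (2 * Real.pi * Complex.I / 3)

/-- `ζ = e^{2πi/9}`. -/
noncomputable def ζ : ℂ := Complex.exp (2 * Real.pi * Complex.I / 9)

/-- The qutrit gate `H = (1/(i√3))·[[1,1,1],[1,ω,ω²],[1,ω²,ω]]`. -/
noncomputable def H3 : Matrix (Fin 3) (Fin 3) ℂ :=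
  (Complex.I * (Real.sqrt 3 : ℂ))⁻¹ • !![1, 1, 1; 1, ω, ω ^ 2; 1, ω ^ 2, ω]

/-- The qutrit gate `S = diag(1, 1, ω)`. -/
noncomputable def S3 : Matrix (Fin 3) (Fin 3) ℂ := !![1, 0, 0; 0, 1, 0; 0, 0, ω]

/-- The qutrit gate `T = diag(1, ζ, ζ⁻¹)`. -/
noncomputable def T3 : Matrix (Fin 3) (Fin 3) ℂ := !![1, 0, 0; 0, ζ, 0; 0, 0, ζ⁻¹]

/-- The qutrit gate `R = diag(1, 1, −1)`. -/
def R3 : Matrix (Fin 3) (Fin 3) ℂ := !![1, 0, 0; 0, 1, 0; 0, 0, -1]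

theorem omega_eq : ω = -1/2 + Complex.I * (Real.sqrt 3 : ℂ) / 2 := by
  unfold ω
  have h : (2 * Real.pi * Complex.I / 3 : ℂ) = ((Real.pi - Real.pi / 3 : ℝ) : ℂ) * Complex.I := by
    push_cast; ring
  rw [h, Complex.exp_mul_I, ← Complex.ofReal_cos, ← Complex.ofReal_sin, Real.cos_pi_sub,
    Real.sin_pi_sub, Real.cos_pi_div_three, Real.sin_pi_div_three]
  push_cast; ring

theorem sqrt3_sq : ((Real.sqrt 3 : ℝ) : ℂ) ^ 2 = 3 := by
  rw [← Complex.ofReal_pow, Real.sq_sqrt (by norm_num)]; norm_num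

theorem det_H3 : H3.det = 1 := by
  have h3 := sqrt3_sq
  have hI := Complex.I_sq
  have hs : (Complex.I * (Real.sqrt 3 : ℂ)) ^ 2 = -3 := by rw [mul_pow, h3, hI]; norm_num
  have hw := omega_eq
  unfold H3
  rw [Matrix.det_smul, Matrix.det_fin_three]
  simp only [Fintype.card_fin]
  generalize Complex.I * (Real.sqrt 3 : ℂ) = t at *
  have ht : t ≠ 0 := by rintro rfl; norm_num at hs
  simp
  rw [hw]
  field_simp
  have h4 : t ^ 4 = 9 := by linear_combination (t ^ 2 - 3) * hs
  have h3' : t ^ 3 = -3 * t := by linear_combination t * hs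
  ring_nf
  simp only [h4, h3', hs]
  ring

theorem omega_cube : ω ^ 3 = 1 := by
  unfold ω
  rw [← Complex.exp_nat_mul, ← Complex.exp_two_pi_mul_I]
  congr 1; push_cast; ring

/-- The gate `R = diag(1, 1, −1)` is not an element of the single-qutrit
Clifford+`T` group, i.e. the subgroup of the unitary group `U(3, ℂ)` generated by the
matrices `H`, `S` and `T`. -/
theorem R_not_in_single_qutrit_cliffordT :
    ¬ ∃ W ∈ Subgroup.closure
        {W : Matrix.unitaryGroup (Fin 3) ℂ |
          (W : Matrix (Fin 3) (Fin 3) ℂ) = H3 ∨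
          (W : Matrix (Fin 3) (Fin 3) ℂ) = S3 ∨
          (W : Matrix (Fin 3) (Fin 3) ℂ) = T3},
      (W : Matrix (Fin 3) (Fin 3) ℂ) = R3 := by
  rintro ⟨W, hW, hR⟩
  have key : (W : Matrix (Fin 3) (Fin 3) ℂ).det ^ 3 = 1 := by
    clear hR
    induction hW using Subgroup.closure_induction with
    | mem x hx =>
      rcases hx with h | h | h
      · rw [h, det_H3, one_pow]
      · rw [h, S3, Matrix.det_fin_three]; simp [omega_cube]
      · have hz : ζ ≠ 0 := Complex.exp_ne_zero _
        rw [h, T3, Matrix.det_fin_three]; simp [hz]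
    | one => simp
    | mul x y _ _ hx hy =>
      rw [Matrix.UnitaryGroup.mul_val, Matrix.det_mul, mul_pow, hx, hy, one_mul]
    | inv x _ hx =>
      rw [Matrix.UnitaryGroup.inv_val, Matrix.star_eq_conjTranspose, Matrix.det_conjTranspose,
        ← star_pow, hx, star_one]
  rw [hR, R3, Matrix.det_fin_three] at key
  simp at key
  norm_num at key
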